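/- arXiv:2602.09282 — 3 statements merged into one kernel-verified Lean document; each statement's English description precedes it below -/
import Mathlib

section
/- Let n ≥ 1, let M be an n×n complex matrix with 0 ≤ M ≤ I in the Loewner order (i.e., M and I − M are positive semidefinite Hermitian matrices), let ρ be an n×n density matrix (a positive semidefinite Hermitian matrix with trace 1), let γ ∈ [0,1], and suppose Re(trace(M * ρ)) ≥ 1 − γ. Then there exist a finite orthonormal family of vectors (ψ_i)_{i∈I} in ℂⁿ and nonnegative weights (q_i)_{i∈I} with ∑_{i∈I} q_i = 1 such that ρ = ∑_{i∈I} q_i · ψ_i ψ_iᴴ and, letting Bad = { i ∈ I : Re⟨ψ_i, M ψ_i⟩ < 1 − √γ }, one has ∑_{i∈Bad} q_i ≤ √γ. -/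
open Matrix ComplexOrder

/-- Markov's inequality for a finite family of weights, with threshold `s` and mean at most `s ^ 2`;
the strict inequality in the tail makes it valid for `s = 0` as well. -/
theorem sum_weight_filter_lt_le {ι : Type*} [Fintype ι] {q b : ι → ℝ} {s : ℝ}
    (hq : ∀ i, 0 ≤ q i) (hb : ∀ i, 0 ≤ b i) (hs : 0 ≤ s) (h : ∑ i, q i * b i ≤ s ^ 2) :
    ∑ i with s < b i, q i ≤ s := by
  have hqb : ∀ i ∈ Finset.univ, 0 ≤ q i * b i := fun i _ => mul_nonneg (hq i) (hb i)
  rcases hs.eq_or_lt with rfl | hs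
  · have hzero := (Finset.sum_eq_zero_iff_of_nonneg hqb).1
      (le_antisymm (by simpa using h) (Finset.sum_nonneg hqb))
    refine (Finset.sum_eq_zero fun i hi => ?_).le
    exact (mul_eq_zero.1 (hzero i (Finset.mem_univ i))).resolve_right
      (Finset.mem_filter.1 hi).2.ne'
  · refine le_of_mul_le_mul_right ?_ hs
    calc (∑ i with s < b i, q i) * s = ∑ i with s < b i, q i * s := Finset.sum_mul ..
      _ ≤ ∑ i with s < b i, q i * b i := Finset.sum_le_sum fun i hi =>
          mul_le_mul_of_nonneg_left (Finset.mem_filter.1 hi).2.le (hq i)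
      _ ≤ ∑ i, q i * b i :=
          Finset.sum_le_sum_of_subset_of_nonneg (Finset.filter_subset _ _) fun i hi _ => hqb i hi
      _ ≤ s * s := by rwa [← sq]

/-- Spectral decomposition of a Hermitian matrix as a sum of rank-one projections. -/
theorem Matrix.IsHermitian.eq_sum_eigenvalues_smul_vecMulVec {n : Type*} [Fintype n]
    [DecidableEq n] {A : Matrix n n ℂ} (hA : A.IsHermitian) :
    A = ∑ i, (hA.eigenvalues i : ℂ) •
      vecMulVec ⇑(hA.eigenvectorBasis i) (star ⇑(hA.eigenvectorBasis i)) := by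
  ext j k
  conv_lhs => rw [hA.spectral_theorem, Unitary.conjStarAlgAut_apply, mul_apply]
  simp [mul_diagonal, sum_apply, vecMulVec_apply, star_apply, mul_comm, ← mul_assoc]

/-- The eigenvector basis of a Hermitian matrix is orthonormal for the dot product. -/
theorem Matrix.IsHermitian.star_eigenvectorBasis_dotProduct {n : Type*} [Fintype n]
    [DecidableEq n] {A : Matrix n n ℂ} (hA : A.IsHermitian) (i j : n) :
    star ⇑(hA.eigenvectorBasis i) ⬝ᵥ ⇑(hA.eigenvectorBasis j) = if i = j then (1 : ℂ) else 0 := by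
  rw [← orthonormal_iff_ite.1 hA.eigenvectorBasis.orthonormal i j,
    EuclideanSpace.inner_eq_star_dotProduct, dotProduct_comm]

/-- The acceptance probability of a mixture is the mean of those of its components. -/
theorem re_trace_mul_sum_smul_vecMulVec {n ι : Type*} [Fintype n] [Fintype ι]
    (M : Matrix n n ℂ) (q : ι → ℝ) (ψ : ι → n → ℂ) :
    (M * ∑ i, (q i : ℂ) • vecMulVec (ψ i) (star (ψ i))).trace.re =
      ∑ i, q i * (star (ψ i) ⬝ᵥ M *ᵥ ψ i).re := by
  simp [Finset.mul_sum, trace_sum, mul_vecMulVec, trace_vecMulVec, dotProduct_comm]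

/-- The "Mixed to Pure" lemma for matrices: if a binary-outcome measurement with
accept operator `M` (with `0 ≤ M ≤ I` in the Loewner order) accepts the density
matrix `ρ` with probability at least `1 - γ`, then `ρ` can be written as a
mixture `∑ q i • ψ_i ψ_iᴴ` over a finite orthonormal family of pure states, where
the total weight on pure states accepted with probability below `1 - √γ` is at
most `√γ`. -/
theorem mixed_to_pure
    {n : ℕ} (hn : 1 ≤ n)
    (M ρ : Matrix (Fin n) (Fin n) ℂ)
    (hM₀ : M.PosSemidef) (hM₁ : (1 - M).PosSemidef)
    (hρ : ρ.PosSemidef) (hρtr : ρ.trace = 1)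
    (γ : ℝ) (hγ : 0 ≤ γ ∧ γ ≤ 1)
    (hacc : 1 - γ ≤ ((M * ρ).trace).re) :
    ∃ (ι : Type) (_ : Fintype ι) (_ : DecidableEq ι) (ψ : ι → Fin n → ℂ) (q : ι → ℝ),
      (∀ i j, star (ψ i) ⬝ᵥ ψ j = if i = j then (1 : ℂ) else 0) ∧
      (∀ i, 0 ≤ q i) ∧ (∑ i, q i = 1) ∧
      ρ = ∑ i, (q i : ℂ) • Matrix.vecMulVec (ψ i) (star (ψ i)) ∧
      ∑ i ∈ Finset.univ.filter
          (fun i => (star (ψ i) ⬝ᵥ M.mulVec (ψ i)).re < 1 - Real.sqrt γ), q i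
        ≤ Real.sqrt γ := by
  obtain ⟨hγ₀, -⟩ := hγ
  have hH := hρ.isHermitian
  have horth := hH.star_eigenvectorBasis_dotProduct
  have hdecomp := hH.eq_sum_eigenvalues_smul_vecMulVec
  have hsum : ∑ i, hH.eigenvalues i = 1 := by
    have h := hH.trace_eq_sum_eigenvalues
    rw [hρtr] at h
    exact Complex.ofReal_injective (by simpa using h.symm)
  refine ⟨Fin n, inferInstance, inferInstance, fun i => ⇑(hH.eigenvectorBasis i), hH.eigenvalues,
    horth, hρ.eigenvalues_nonneg, hsum, hdecomp, ?_⟩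
  set a : Fin n → ℝ := fun i =>
    (star ⇑(hH.eigenvectorBasis i) ⬝ᵥ M *ᵥ ⇑(hH.eigenvectorBasis i)).re
  have ha₁ : ∀ i, 0 ≤ 1 - a i := fun i => by
    simpa [sub_mulVec, dotProduct_sub, horth] using
      hM₁.re_dotProduct_nonneg ⇑(hH.eigenvectorBasis i)
  have hmean : ∑ i, hH.eigenvalues i * (1 - a i) ≤ √γ ^ 2 := by
    rw [hdecomp, re_trace_mul_sum_smul_vecMulVec] at hacc
    simp only [mul_sub, mul_one, Finset.sum_sub_distrib, hsum, Real.sq_sqrt hγ₀]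
    linarith
  simpa only [lt_sub_comm] using
    sum_weight_filter_lt_le hρ.eigenvalues_nonneg ha₁ (Real.sqrt_nonneg γ) hmean
end

section
/- Let n ≥ 1, let V be an n×n Hermitian complex matrix with 0 ≤ V ≤ I in the Loewner order, let (v_j)_{j} be an orthonormal eigenbasis of V with corresponding real eigenvalues (p_j)_j, each lying in [0,1]. Let η ∈ [0,1] and let φ ∈ ℂⁿ be a unit vector with Re⟨φ, V φ⟩ ≥ 1 − η. Then ∑_{j : p_j < 1 − √η} |⟨v_j, φ⟩|² ≤ √η. In other words, the squared norm of the component of φ in the span of eigenvectors of V with eigenvalue below 1 − √η is at most √η. -/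
open Matrix ComplexOrder

/-- Parseval's identity for an orthonormal family of full size in `ℂⁿ`. -/
theorem star_dotProduct_eq_sum_of_orthonormal {ι : Type*} [Fintype ι] [DecidableEq ι]
    {v : ι → ι → ℂ} (horth : ∀ j k, star (v j) ⬝ᵥ v k = if j = k then (1 : ℂ) else 0)
    (x y : ι → ℂ) :
    star x ⬝ᵥ y = ∑ j, star (star (v j) ⬝ᵥ x) * (star (v j) ⬝ᵥ y) := by
  let U : Matrix ι ι ℂ := (Matrix.of v)ᵀ
  have hU : Uᴴ * U = 1 := by
    ext j k
    rw [Matrix.one_apply, ← horth j k]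
    rfl
  calc star x ⬝ᵥ y = star x ⬝ᵥ ((U * Uᴴ) *ᵥ y) := by
        rw [mul_eq_one_comm.mp hU, Matrix.one_mulVec]
    _ = star (Uᴴ *ᵥ x) ⬝ᵥ (Uᴴ *ᵥ y) := by
        rw [← Matrix.mulVec_mulVec, Matrix.dotProduct_mulVec, Matrix.star_mulVec,
          Matrix.conjTranspose_conjTranspose]
    _ = _ := rfl

/-- A Hermitian matrix acts on the coefficient along an eigenvector by the eigenvalue. -/
theorem star_dotProduct_mulVec_of_eigenvector {ι : Type*} [Fintype ι]
    {V : Matrix ι ι ℂ} (hV : V.IsHermitian) {v : ι → ℂ} {p : ℝ}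
    (heig : V.mulVec v = (p : ℂ) • v) (x : ι → ℂ) :
    star v ⬝ᵥ V.mulVec x = p * (star v ⬝ᵥ x) := by
  have h : star v ᵥ* V = star (V *ᵥ v) := by rw [Matrix.star_mulVec, hV.eq]
  rw [Matrix.dotProduct_mulVec, h, heig, star_smul, smul_dotProduct]
  simp

/-- Markov's inequality at the threshold `s`, when the average of `1 - p` is at most `s ^ 2`. -/
theorem sum_filter_lt_one_sub_le {ι : Type*} [Fintype ι] {p w : ι → ℝ} {s : ℝ}
    (hp : ∀ j, p j ≤ 1) (hw : ∀ j, 0 ≤ w j) (hs : 0 ≤ s)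
    (h : ∑ j, (1 - p j) * w j ≤ s ^ 2) :
    ∑ j ∈ Finset.univ.filter (fun j => p j < 1 - s), w j ≤ s := by
  have hnonneg (j : ι) : 0 ≤ (1 - p j) * w j := mul_nonneg (sub_nonneg.mpr (hp j)) (hw j)
  rcases hs.eq_or_lt with rfl | hs
  · refine (Finset.sum_eq_zero fun j hj => ?_).le
    have hle : (1 - p j) * w j ≤ 0 :=
      (Finset.single_le_sum (fun i _ => hnonneg i) (Finset.mem_univ j)).trans (by simpa using h)
    have hlt := (Finset.mem_filter.mp hj).2
    exact le_antisymm (nonpos_of_mul_nonpos_right hle (by linarith)) (hw j)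
  · refine le_of_mul_le_mul_left ?_ hs
    rw [Finset.mul_sum, ← sq]
    refine le_trans (Finset.sum_le_sum fun j hj => ?_)
      ((Finset.sum_le_univ_sum_of_nonneg hnonneg).trans h)
    have hlt := (Finset.mem_filter.mp hj).2
    exact mul_le_mul_of_nonneg_right (by linarith) (hw j)

/-- Eigenvalue-mass bound: if `V` is Hermitian with `0 ≤ V ≤ I`, `(v j)` is an
orthonormal eigenbasis of `V` with eigenvalues `p j ∈ [0,1]`, and `φ` is a unit
vector accepted with probability at least `1 - η` (i.e. `Re⟨φ, Vφ⟩ ≥ 1 - η`),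
then the squared mass of `φ` on eigenvectors with eigenvalue below `1 - √η` is
at most `√η`. -/
theorem eigenvalue_mass_bound
    {n : ℕ} (hn : 1 ≤ n)
    (V : Matrix (Fin n) (Fin n) ℂ)
    (hV : V.IsHermitian)
    (hV₀ : V.PosSemidef) (hV₁ : (1 - V).PosSemidef)
    (v : Fin n → Fin n → ℂ) (p : Fin n → ℝ)
    (horth : ∀ j k, star (v j) ⬝ᵥ v k = if j = k then (1 : ℂ) else 0)
    (heig : ∀ j, V.mulVec (v j) = (p j : ℂ) • v j)
    (hp : ∀ j, 0 ≤ p j ∧ p j ≤ 1)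
    (η : ℝ) (hη : 0 ≤ η ∧ η ≤ 1)
    (φ : Fin n → ℂ) (hφ : star φ ⬝ᵥ φ = 1)
    (hacc : 1 - η ≤ (star φ ⬝ᵥ V.mulVec φ).re) :
    ∑ j ∈ Finset.univ.filter (fun j => p j < 1 - Real.sqrt η),
        ‖star (v j) ⬝ᵥ φ‖ ^ 2 ≤ Real.sqrt η := by
  have hnorm : ∑ j, ‖star (v j) ⬝ᵥ φ‖ ^ 2 = 1 := by
    rw [star_dotProduct_eq_sum_of_orthonormal horth] at hφ
    simp only [Complex.star_def, Complex.conj_mul'] at hφ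
    exact_mod_cast hφ
  have hexp : star φ ⬝ᵥ V.mulVec φ = ((∑ j, p j * ‖star (v j) ⬝ᵥ φ‖ ^ 2 : ℝ) : ℂ) := by
    rw [star_dotProduct_eq_sum_of_orthonormal horth]
    push_cast
    refine Finset.sum_congr rfl fun j _ => ?_
    rw [star_dotProduct_mulVec_of_eigenvector hV (heig j), mul_left_comm, Complex.star_def,
      Complex.conj_mul']
  rw [hexp, Complex.ofReal_re] at hacc
  refine sum_filter_lt_one_sub_le (fun j => (hp j).2) (fun j => sq_nonneg _)
    (Real.sqrt_nonneg η) ?_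
  simp only [sub_mul, one_mul, Finset.sum_sub_distrib]
  rw [hnorm, Real.sq_sqrt hη.1]
  linarith
end

section
/- Let n ≥ 1 and let V be an n×n Hermitian complex matrix. In ℂ³ with standard basis e₀, e₁, e₂, let w = (1/√2)·e₀ + (1/2)·e₁ + (1/2)·e₂, let E₀₀ = e₀e₀ᴴ and E₁₁ = e₁e₁ᴴ, let Π_G = V ⊗ E₀₀ + Iₙ ⊗ E₁₁, and let W = Iₙ ⊗ (wwᴴ), where ⊗ denotes the Kronecker product of matrices. If ψ ∈ ℂⁿ is a unit eigenvector of V with eigenvalue p, then the vector ψ ⊗ w ∈ ℂ^(n·3) (the Kronecker product of the column vectors ψ and w) is an eigenvector of the matrix W · Π_G · W with eigenvalue p/2 + 1/4. -/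
open Matrix

/-- The standard basis vector `e_i` of `ℂ³`. -/
def stdVec3 (i : Fin 3) : Fin 3 → ℂ := fun k => if k = i then 1 else 0

/-- The auxiliary unit vector `w = (1/√2)·e₀ + (1/2)·e₁ + (1/2)·e₂ ∈ ℂ³`. -/
noncomputable def wVec : Fin 3 → ℂ :=
  ((Real.sqrt 2 : ℂ))⁻¹ • stdVec3 0 + (1 / 2 : ℂ) • stdVec3 1 + (1 / 2 : ℂ) • stdVec3 2

/-- `E₀₀ = e₀ e₀ᴴ`. -/
def E00 : Matrix (Fin 3) (Fin 3) ℂ := Matrix.vecMulVec (stdVec3 0) (star (stdVec3 0))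

/-- `E₁₁ = e₁ e₁ᴴ`. -/
def E11 : Matrix (Fin 3) (Fin 3) ℂ := Matrix.vecMulVec (stdVec3 1) (star (stdVec3 1))

/-- `Π_G = V ⊗ E₀₀ + Iₙ ⊗ E₁₁`, acting on `ℂⁿ ⊗ ℂ³`. -/
def PiG {n : ℕ} (V : Matrix (Fin n) (Fin n) ℂ) :
    Matrix (Fin n × Fin 3) (Fin n × Fin 3) ℂ :=
  Matrix.kroneckerMap (· * ·) V E00 +
    Matrix.kroneckerMap (· * ·) (1 : Matrix (Fin n) (Fin n) ℂ) E11

/-- `W = Iₙ ⊗ (w wᴴ)`. -/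
noncomputable def WMat (n : ℕ) : Matrix (Fin n × Fin 3) (Fin n × Fin 3) ℂ :=
  Matrix.kroneckerMap (· * ·) (1 : Matrix (Fin n) (Fin n) ℂ)
    (Matrix.vecMulVec wVec (star wVec))

/-- A Kronecker product of matrices acts factorwise on a Kronecker product of vectors. -/
theorem kroneckerMap_mulVec_prod {l m n k R : Type*} [Fintype m] [Fintype k] [CommSemiring R]
    (A : Matrix l m R) (B : Matrix n k R) (x : m → R) (y : k → R) :
    (Matrix.kroneckerMap (· * ·) A B).mulVec (fun q => x q.1 * y q.2) =
      fun q => A.mulVec x q.1 * B.mulVec y q.2 := by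
  ext q
  simp only [Matrix.mulVec, dotProduct, Matrix.kroneckerMap_apply, Fintype.sum_prod_type,
    Finset.sum_mul_sum]
  exact Finset.sum_congr rfl fun i _ => Finset.sum_congr rfl fun j _ => by ring

theorem inv_ofReal_sqrt_two_mul_self : ((Real.sqrt 2 : ℂ))⁻¹ * ((Real.sqrt 2 : ℂ))⁻¹ = 1 / 2 := by
  rw [← mul_inv, ← Complex.ofReal_mul, Real.mul_self_sqrt zero_le_two]
  norm_num

theorem star_wVec_dotProduct_wVec : star wVec ⬝ᵥ wVec = 1 := by
  simp [dotProduct, Fin.sum_univ_three, wVec, stdVec3, Complex.conj_ofNat]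
  linear_combination inv_ofReal_sqrt_two_mul_self

theorem star_wVec_dotProduct_E00 : star wVec ⬝ᵥ E00.mulVec wVec = 1 / 2 := by
  simp [dotProduct, Matrix.mulVec, E00, Matrix.vecMulVec_apply, wVec, stdVec3]
  linear_combination inv_ofReal_sqrt_two_mul_self

theorem star_wVec_dotProduct_E11 : star wVec ⬝ᵥ E11.mulVec wVec = 1 / 4 := by
  simp [dotProduct, Matrix.mulVec, E11, Matrix.vecMulVec_apply, wVec, stdVec3,
    Complex.conj_ofNat]
  norm_num

theorem WMat_mulVec_prod {n : ℕ} (x : Fin n → ℂ) (y : Fin 3 → ℂ) :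
    (WMat n).mulVec (fun q => x q.1 * y q.2) =
      (star wVec ⬝ᵥ y) • fun q => x q.1 * wVec q.2 := by
  rw [WMat, kroneckerMap_mulVec_prod]
  ext q
  simp only [Matrix.one_mulVec, Matrix.vecMulVec_mulVec, Pi.smul_apply, MulOpposite.smul_eq_mul_unop,
    MulOpposite.unop_op, smul_eq_mul]
  ring

/-- If `ψ` is a unit eigenvector of the Hermitian matrix `V` with eigenvalue
`p`, then `ψ ⊗ w` is an eigenvector of `W · Π_G · W` with eigenvalue
`p/2 + 1/4`. -/
theorem valest_jordan_eigenvector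
    {n : ℕ} (hn : 1 ≤ n) (V : Matrix (Fin n) (Fin n) ℂ)
    (hV : V.IsHermitian)
    (ψ : Fin n → ℂ) (p : ℝ)
    (hψunit : star ψ ⬝ᵥ ψ = 1)
    (hψeig : V.mulVec ψ = (p : ℂ) • ψ) :
    (WMat n * PiG V * WMat n).mulVec (fun q => ψ q.1 * wVec q.2) =
      ((p / 2 + 1 / 4 : ℝ) : ℂ) • (fun q => ψ q.1 * wVec q.2) := by
  have hPi : (PiG V).mulVec (fun q => ψ q.1 * wVec q.2) =
      (p : ℂ) • (fun q => ψ q.1 * E00.mulVec wVec q.2) +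
        fun q => ψ q.1 * E11.mulVec wVec q.2 := by
    rw [PiG, Matrix.add_mulVec, kroneckerMap_mulVec_prod, kroneckerMap_mulVec_prod, hψeig,
      Matrix.one_mulVec]
    ext q
    simp [mul_assoc]
  rw [← Matrix.mulVec_mulVec, ← Matrix.mulVec_mulVec, WMat_mulVec_prod,
    star_wVec_dotProduct_wVec, one_smul, hPi, Matrix.mulVec_add, Matrix.mulVec_smul,
    WMat_mulVec_prod, WMat_mulVec_prod, star_wVec_dotProduct_E00, star_wVec_dotProduct_E11,
    smul_smul, ← add_smul]
  congr 1
  push_cast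
  ring
end
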